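/- arXiv:1603.04151 — 2 statements merged into one kernel-verified Lean document; each statement's English description precedes it below -/
import Mathlib

section
/- Let A be an m×m real symmetrizable matrix with m ≥ 2, and let λ be a real number with det(A − λI_m) = 0 (i.e., λ is an eigenvalue of A). Then for all k, l ∈ {1,...,m}, the product det((A − λI_m)_k) · det((A − λI_m)_l) ≥ 0, where M_k denotes the (m−1)×(m−1) principal submatrix of M obtained by deleting row k and column k; that is, all principal minors of order m−1 of A − λI_m have the same sign (allowing zeros). -/
/-- A real square matrix is *symmetrizable* if some diagonal matrix with
strictly positive entries makes it symmetric by left multiplication. -/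
def Matrix.Symmetrizable {n : Type*} [Fintype n] [DecidableEq n]
    (A : Matrix n n ℝ) : Prop :=
  ∃ d : n → ℝ, (∀ i, 0 < d i) ∧ (Matrix.diagonal d * A).IsSymm

namespace Matrix

/-- The diagonal entries of the adjugate are the principal minors. -/
theorem adjugate_apply_self_eq_det_submatrix {R : Type*} [CommRing R] {n : ℕ}
    (M : Matrix (Fin (n + 1)) (Fin (n + 1)) R) (k : Fin (n + 1)) :
    M.adjugate k k = (M.submatrix k.succAbove k.succAbove).det := by
  rw [adjugate_fin_succ_eq_det_submatrix, Even.neg_one_pow ⟨_, rfl⟩, one_mul]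

/-- The principal `2 × 2` minors of the adjugate of a singular matrix vanish, provided one of
the two diagonal entries involved is nonzero. -/
theorem adjugate_apply_self_mul_apply_self {K : Type*} [Field K] {n : ℕ}
    {M : Matrix (Fin (n + 1)) (Fin (n + 1)) K} (hdet : M.det = 0) (k : Fin (n + 1))
    {l : Fin (n + 1)} (hl : M.adjugate l l ≠ 0) :
    M.adjugate k k * M.adjugate l l = M.adjugate k l * M.adjugate l k := by
  rw [adjugate_apply_self_eq_det_submatrix] at hl
  set P := M.adjugate
  have hMP : ∀ i j, ∑ x, M i x * P x j = 0 := fun i j ↦ by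
    simpa [mul_apply, hdet] using congrFun₂ (mul_adjugate M) i j
  have hw : (fun x ↦ P l l * P (l.succAbove x) k - P l k * P (l.succAbove x) l) = 0 := by
    refine eq_zero_of_mulVec_eq_zero hl (funext fun i ↦ ?_)
    have hk := hMP (l.succAbove i) k
    have hl' := hMP (l.succAbove i) l
    rw [Fin.sum_univ_succAbove _ l] at hk hl'
    simp only [mulVec, dotProduct, submatrix_apply, Pi.zero_apply, mul_sub,
      mul_left_comm (M _ _), Finset.sum_sub_distrib, ← Finset.mul_sum]
    linear_combination P l l * hk - P l k * hl'
  rcases eq_or_ne k l with rfl | hkl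
  · rfl
  · obtain ⟨x, rfl⟩ := Fin.exists_succAbove_eq hkl
    have := congrFun hw x
    simp only [Pi.zero_apply] at this
    linear_combination this

/-- Symmetric off-diagonal entries of the adjugate of a symmetrizable matrix have the same sign. -/
theorem Symmetrizable.adjugate_apply_mul_apply_nonneg {n : Type*} [Fintype n] [DecidableEq n]
    {M : Matrix n n ℝ} (hM : M.Symmetrizable) (k l : n) :
    0 ≤ M.adjugate k l * M.adjugate l k := by
  obtain ⟨d, hd, hsymm⟩ := hM
  have h : (diagonal d * M).adjugateᵀ = (diagonal d * M).adjugate := by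
    rw [adjugate_transpose, hsymm.eq]
  rw [adjugate_mul_distrib, adjugate_diagonal] at h
  have hkl := congrFun₂ h k l
  simp only [transpose_apply, mul_diagonal] at hkl
  have he : ∀ i, 0 < ∏ j ∈ Finset.univ.erase i, d j := fun i ↦ Finset.prod_pos fun j _ ↦ hd j
  refine nonneg_of_mul_nonneg_left ?_ (he l)
  rw [mul_right_comm, ← hkl, mul_right_comm]
  exact mul_nonneg (mul_self_nonneg _) (he k).le

theorem Symmetrizable.sub_smul_one {n : Type*} [Fintype n] [DecidableEq n]
    {A : Matrix n n ℝ} (hA : A.Symmetrizable) (c : ℝ) :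
    (A - c • (1 : Matrix n n ℝ)).Symmetrizable := by
  obtain ⟨d, hd, hsymm⟩ := hA
  refine ⟨d, hd, ?_⟩
  rw [mul_sub, mul_smul_comm, mul_one]
  exact hsymm.sub ((isSymm_diagonal d).smul c)

end Matrix

/-- If `A` is an `(n+1) × (n+1)` real symmetrizable matrix (`n + 1 ≥ 2`) and
`λ` is a real eigenvalue of `A`, then all principal minors of order `n` of
`A - λI` have the same sign (allowing zeros): the product of any two of them
is nonnegative. -/
theorem symmetrizable_principal_minors_same_sign (n : ℕ) (hn : 1 ≤ n)
    (A : Matrix (Fin (n + 1)) (Fin (n + 1)) ℝ) (hA : A.Symmetrizable)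
    (lam : ℝ)
    (M : Matrix (Fin (n + 1)) (Fin (n + 1)) ℝ)
    (hM : M = A - lam • (1 : Matrix (Fin (n + 1)) (Fin (n + 1)) ℝ))
    (hdet : M.det = 0) :
    ∀ k l : Fin (n + 1),
      0 ≤ (M.submatrix k.succAbove k.succAbove).det *
            (M.submatrix l.succAbove l.succAbove).det := by
  intro k l
  subst hM
  simp only [← Matrix.adjugate_apply_self_eq_det_submatrix]
  by_cases hl : (A - lam • (1 : Matrix (Fin (n + 1)) (Fin (n + 1)) ℝ)).adjugate l l = 0
  · rw [hl, mul_zero]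
  · rw [Matrix.adjugate_apply_self_mul_apply_self hdet k hl]
    exact (hA.sub_smul_one lam).adjugate_apply_mul_apply_nonneg k l
end

section
/- (Dodgson/Desnanot–Jacobi identity) Let R be a commutative ring, let A be an m×m matrix over R with m ≥ 2, and let k, l ∈ {1,...,m} with k ≠ l. Denote by A^{i,j} the (m−1)×(m−1) matrix obtained from A by deleting row i and column j, and by A^{kl,kl} the (m−2)×(m−2) matrix obtained from A by deleting rows k and l and columns k and l (interpreted as the empty matrix with determinant 1 when m = 2). Then det(A) · det(A^{kl,kl}) = det(A^{l,l}) · det(A^{k,k}) − det(A^{l,k}) · det(A^{k,l}). -/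
open Matrix in
/-- **Jacobi's complementary minor formula** for a leading block of the adjugate. -/
theorem Matrix.det_toBlocks₁₁_adjugate {m n R : Type*} [Fintype m] [DecidableEq m] [Nonempty m]
    [Fintype n] [DecidableEq n] [CommRing R] (A : Matrix (m ⊕ n) (m ⊕ n) R) :
    A.adjugate.toBlocks₁₁.det = A.det ^ (Fintype.card m - 1) * A.toBlocks₂₂.det := by
  let X := mvPolynomialX (m ⊕ n) (m ⊕ n) ℤ
  suffices h : X.adjugate.toBlocks₁₁.det = X.det ^ (Fintype.card m - 1) * X.toBlocks₂₂.det by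
    let f := MvPolynomial.aeval (R := ℤ) fun p : (m ⊕ n) × (m ⊕ n) ↦ A p.1 p.2
    have hX : f.mapMatrix X = A := mvPolynomialX_mapMatrix_aeval ℤ A
    have hf := congrArg f h
    rw [map_mul, map_pow, AlgHom.map_det, AlgHom.map_det, AlgHom.map_det] at hf
    have h₁ : f.mapMatrix X.adjugate.toBlocks₁₁ = A.adjugate.toBlocks₁₁ := by
      rw [← hX, ← AlgHom.map_adjugate]
      rfl
    have h₂ : f.mapMatrix X.toBlocks₂₂ = A.toBlocks₂₂ := by
      rw [← hX]
      rfl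
    rwa [h₁, h₂, hX] at hf
  have hmul : X * fromBlocks X.adjugate.toBlocks₁₁ 0 X.adjugate.toBlocks₂₁ 1 =
      fromBlocks (X.det • (1 : Matrix m m _)) X.toBlocks₁₂ 0 X.toBlocks₂₂ := by
    have h := mul_adjugate X
    rw [← fromBlocks_toBlocks X.adjugate, ← fromBlocks_one, fromBlocks_smul] at h
    nth_rewrite 1 [← fromBlocks_toBlocks X] at h
    rw [fromBlocks_multiply, fromBlocks_inj] at h
    nth_rewrite 1 [← fromBlocks_toBlocks X]
    rw [fromBlocks_multiply, h.1, h.2.2.1]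
    simp
  have hdet := congrArg det hmul
  rw [det_mul, det_fromBlocks_zero₁₂, det_fromBlocks_zero₂₁, det_smul, det_one, det_one,
    mul_one, mul_one] at hdet
  refine mul_left_cancel₀ (det_mvPolynomialX_ne_zero (m ⊕ n) ℤ) ?_
  rw [← mul_assoc, mul_pow_sub_one Fintype.card_ne_zero]
  exact hdet


/-- **Dodgson / Desnanot–Jacobi identity.** Let `A` be an `(n+2) × (n+2)`
matrix over a commutative ring and let `k ≠ l` be two indices (here `l` is
encoded as `k.succAbove l'`, which ranges exactly over the indices different
from `k`). Writing `A^{i,j}` for the matrix obtained by deleting row `i` and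
column `j`, and `A^{kl,kl}` for the matrix obtained by deleting rows `k, l`
and columns `k, l`, we have
`det A · det A^{kl,kl} = det A^{l,l} · det A^{k,k} − det A^{l,k} · det A^{k,l}`. -/
theorem dodgson_identity {R : Type*} [CommRing R] (n : ℕ)
    (A : Matrix (Fin (n + 2)) (Fin (n + 2)) R)
    (k l : Fin (n + 2)) (hkl : k ≠ l)
    (l' : Fin (n + 1)) (hl' : k.succAbove l' = l) :
    A.det *
        (A.submatrix (k.succAbove ∘ l'.succAbove)
          (k.succAbove ∘ l'.succAbove)).det =
      (A.submatrix l.succAbove l.succAbove).det *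
          (A.submatrix k.succAbove k.succAbove).det -
        (A.submatrix l.succAbove k.succAbove).det *
          (A.submatrix k.succAbove l.succAbove).det := by
  have hinj : Function.Injective
      (Sum.elim ![k, l] (k.succAbove ∘ l'.succAbove) : Fin 2 ⊕ Fin n → Fin (n + 2)) := by
    refine Function.Injective.sumElim ?_
      (Fin.succAbove_right_injective.comp Fin.succAbove_right_injective) ?_
    · intro i j h
      fin_cases i <;> fin_cases j <;> simp_all [hkl.symm]
    · intro i j
      fin_cases i
      · exact (Fin.succAbove_ne _ _).symm
      · intro h
        exact Fin.succAbove_ne l' j (Fin.succAbove_right_injective (hl'.trans h)).symm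
  let e : Fin 2 ⊕ Fin n ≃ Fin (n + 2) := Equiv.ofBijective _
    ((Fintype.bijective_iff_injective_and_card _).2 ⟨hinj, by simp [add_comm]⟩)
  have h := Matrix.det_toBlocks₁₁_adjugate (A.submatrix e e)
  rw [Matrix.adjugate_submatrix_equiv_self, Matrix.det_submatrix_equiv_self, Fintype.card_fin,
    pow_one, Matrix.det_fin_two] at h
  change A.adjugate k k * A.adjugate l l - A.adjugate k l * A.adjugate l k =
    A.det * (A.submatrix (k.succAbove ∘ l'.succAbove) (k.succAbove ∘ l'.succAbove)).det at h
  rw [← h]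
  simp only [Matrix.adjugate_fin_succ_eq_det_submatrix]
  have hk : ((-1 : R) ^ (k : ℕ)) ^ 2 = 1 := by rw [← pow_mul, mul_comm, pow_mul]; simp
  have hl : ((-1 : R) ^ (l : ℕ)) ^ 2 = 1 := by rw [← pow_mul, mul_comm, pow_mul]; simp
  simp only [pow_add]
  generalize (-1 : R) ^ (k : ℕ) = x at *
  generalize (-1 : R) ^ (l : ℕ) = y at *
  have hxy : x ^ 2 * y ^ 2 = 1 := by rw [hk, hl, one_mul]
  linear_combination
    ((A.submatrix l.succAbove l.succAbove).det * (A.submatrix k.succAbove k.succAbove).det -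
      (A.submatrix l.succAbove k.succAbove).det *
        (A.submatrix k.succAbove l.succAbove).det) * hxy
end
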